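/- Let A_1 and A_2 be complex 2×2 matrices with det A_1 = det A_2 = 1, and let r > 0. Then there exist 2×2 complex unitary matrices U_1, U_2, V such that U_1† A_1 V is upper-triangular with diagonal entries r and 1/r (in this order) and U_2† A_2 V is lower-triangular with diagonal entries r and 1/r (in this order), if and only if the following three conditions hold: det(A_1†A_1 − r²I) ≤ 0, det(A_2†A_2 − (1/r²)I) ≤ 0, and F_2(A_1†A_1 − r²I, A_2†A_2 − (1/r²)I) ≥ 0. -/

import Mathlib

open Matrix ComplexOrder

/-- `F₂(S₁, S₂) = det (S₁ · S₂ − adj(S₂) · adj(S₁))`. -/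
noncomputable def F2 {n : ℕ} (S₁ S₂ : Matrix (Fin n) (Fin n) ℂ) : ℂ :=
  (S₁ * S₂ - S₂.adjugate * S₁.adjugate).det

/-- The Hermitian matrix `t + x σ₁ + y σ₂ + z σ₃` with Pauli coordinates `(t, x, y, z)`. -/
noncomputable def pauliMatrix (t x y z : ℝ) : Matrix (Fin 2) (Fin 2) ℂ :=
  !![⟨t + z, 0⟩, ⟨x, -y⟩; ⟨x, y⟩, ⟨t - z, 0⟩]

theorem Matrix.IsHermitian.exists_eq_pauliMatrix {M : Matrix (Fin 2) (Fin 2) ℂ}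
    (hM : M.IsHermitian) : ∃ t x y z : ℝ, M = pauliMatrix t x y z := by
  have h00 := congrArg Complex.im (hM.apply 0 0)
  have h11 := congrArg Complex.im (hM.apply 1 1)
  have h01 := hM.apply 0 1
  refine ⟨((M 0 0).re + (M 1 1).re) / 2, (M 1 0).re, (M 1 0).im,
    ((M 0 0).re - (M 1 1).re) / 2, ?_⟩
  simp only [RCLike.star_def, Complex.conj_im] at h00 h11
  ext i j
  fin_cases i <;> fin_cases j <;> apply Complex.ext <;>
    simp [pauliMatrix, ← h01] <;> linarith

theorem det_pauliMatrix (t x y z : ℝ) :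
    (pauliMatrix t x y z).det = ((t ^ 2 - (x ^ 2 + y ^ 2 + z ^ 2) : ℝ) : ℂ) := by
  rw [pauliMatrix, Matrix.det_fin_two_of]
  apply Complex.ext
  · simp only [Complex.sub_re, Complex.mul_re, Complex.ofReal_re]; ring
  · simp only [Complex.sub_im, Complex.mul_im, Complex.ofReal_im]; ring

theorem F2_pauliMatrix (t x y z t' x' y' z' : ℝ) :
    F2 (pauliMatrix t x y z) (pauliMatrix t' x' y' z') =
      ((4 * ((y * z' - z * y') ^ 2 + (z * x' - x * z') ^ 2 + (x * y' - y * x') ^ 2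
        - ((t' * x + t * x') ^ 2 + (t' * y + t * y') ^ 2 + (t' * z + t * z') ^ 2)) : ℝ) : ℂ) := by
  rw [F2, Matrix.det_fin_two]
  apply Complex.ext
  · rw [Complex.ofReal_re]
    simp [pauliMatrix, Matrix.adjugate_fin_two]
    ring
  · rw [Complex.ofReal_im]
    simp [pauliMatrix, Matrix.adjugate_fin_two]
    ring

/-- The first diagonal entry of a unitary conjugate of a Hermitian matrix, in terms of the Bloch
vector of the first column of the unitary matrix. -/
theorem conjTranspose_mul_pauliMatrix_mul_zero_zero (t x y z : ℝ) (V : Matrix (Fin 2) (Fin 2) ℂ)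
    (hV : V ∈ Matrix.unitaryGroup (Fin 2) ℂ) :
    (Vᴴ * pauliMatrix t x y z * V) 0 0 =
      ((t + (x * (2 * ((V 0 0).re * (V 1 0).re + (V 0 0).im * (V 1 0).im))
        + y * (2 * ((V 0 0).re * (V 1 0).im - (V 0 0).im * (V 1 0).re))
        + z * ((V 0 0).re ^ 2 + (V 0 0).im ^ 2 - (V 1 0).re ^ 2 - (V 1 0).im ^ 2)) : ℝ) : ℂ) := by
  have h := congrArg Complex.re (congrFun (congrFun (Matrix.mem_unitaryGroup_iff'.1 hV) 0) 0)
  simp [Matrix.star_eq_conjTranspose, Matrix.mul_apply, Fin.sum_univ_two] at h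
  apply Complex.ext
  · rw [Complex.ofReal_re]
    simp [pauliMatrix, Matrix.mul_apply, Fin.sum_univ_two]
    linear_combination t * h
  · rw [Complex.ofReal_im]
    simp [pauliMatrix, Matrix.mul_apply, Fin.sum_univ_two]
    ring

theorem conjTranspose_mul_pauliMatrix_mul_one_one (t x y z : ℝ) (V : Matrix (Fin 2) (Fin 2) ℂ)
    (hV : V ∈ Matrix.unitaryGroup (Fin 2) ℂ) :
    (Vᴴ * pauliMatrix t x y z * V) 1 1 =
      ((t - (x * (2 * ((V 0 0).re * (V 1 0).re + (V 0 0).im * (V 1 0).im))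
        + y * (2 * ((V 0 0).re * (V 1 0).im - (V 0 0).im * (V 1 0).re))
        + z * ((V 0 0).re ^ 2 + (V 0 0).im ^ 2 - (V 1 0).re ^ 2 - (V 1 0).im ^ 2)) : ℝ) : ℂ) := by
  have h : (Vᴴ * pauliMatrix t x y z * V).trace = (pauliMatrix t x y z).trace := by
    rw [Matrix.trace_mul_cycle, ← Matrix.star_eq_conjTranspose, Matrix.mem_unitaryGroup_iff.1 hV,
      one_mul]
  rw [Matrix.trace_fin_two, conjTranspose_mul_pauliMatrix_mul_zero_zero t x y z V hV] at h
  rw [eq_sub_of_add_eq' h]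
  apply Complex.ext
  · simp [pauliMatrix, Matrix.trace_fin_two]
  · simp [pauliMatrix, Matrix.trace_fin_two]

/-- Every unit vector of `ℝ³` is the Bloch vector of the first column of a matrix in `SU(2)`. -/
theorem exists_unitary_bloch_eq (x y z : ℝ) (h : x ^ 2 + y ^ 2 + z ^ 2 = 1) :
    ∃ V : Matrix (Fin 2) (Fin 2) ℂ, V ∈ Matrix.unitaryGroup (Fin 2) ℂ ∧ V.det = 1 ∧
      2 * ((V 0 0).re * (V 1 0).re + (V 0 0).im * (V 1 0).im) = x ∧
      2 * ((V 0 0).re * (V 1 0).im - (V 0 0).im * (V 1 0).re) = y ∧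
      (V 0 0).re ^ 2 + (V 0 0).im ^ 2 - (V 1 0).re ^ 2 - (V 1 0).im ^ 2 = z := by
  obtain ⟨a, b, c, hn, hx, hy, hz⟩ : ∃ a b c : ℝ, a ^ 2 + b ^ 2 + c ^ 2 = 1 ∧
      2 * (a * b) = x ∧ 2 * (a * c) = y ∧ a ^ 2 - b ^ 2 - c ^ 2 = z := by
    have hz : -1 ≤ z := by nlinarith [sq_nonneg x, sq_nonneg y]
    rcases hz.eq_or_lt with hz | hz
    · subst hz
      have hx : x = 0 := by nlinarith [sq_nonneg x, sq_nonneg y]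
      have hy : y = 0 := by nlinarith [sq_nonneg x, sq_nonneg y]
      exact ⟨0, 1, 0, by norm_num, by simp [hx], by simp [hy], by norm_num⟩
    · have hs : √((1 + z) / 2) ^ 2 = (1 + z) / 2 := Real.sq_sqrt (by linarith)
      have hpos : 0 < √((1 + z) / 2) := Real.sqrt_pos.2 (by linarith)
      generalize √((1 + z) / 2) = s at hs hpos
      have hbc : (x / (2 * s)) ^ 2 + (y / (2 * s)) ^ 2 = (1 - z) / 2 := by
        have hz' : 1 + z ≠ 0 := by linarith
        rw [div_pow, div_pow, mul_pow, hs]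
        field_simp
        linear_combination h
      refine ⟨s, x / (2 * s), y / (2 * s), by linarith, by field_simp, by field_simp, by linarith⟩
  refine ⟨!![⟨a, 0⟩, ⟨-b, c⟩; ⟨b, c⟩, ⟨a, 0⟩], ?_, ?_, ?_, ?_, ?_⟩
  · rw [Matrix.mem_unitaryGroup_iff']
    ext i j
    fin_cases i <;> fin_cases j <;> apply Complex.ext <;>
      simp [Matrix.star_eq_conjTranspose, Matrix.mul_apply, Fin.sum_univ_two] <;>
      first | ring1 | linear_combination hn
  · rw [Matrix.det_fin_two_of]
    apply Complex.ext
    · simp; linear_combination hn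
    · simp; ring
  · simpa using hx
  · simpa using hy
  · simp; linear_combination hz

section PlanesAndSphere

variable {a₀ a₁ a₂ a₃ c₀ c₁ c₂ c₃ : ℝ}

/-- Two planes in general position meet the unit sphere at a common point if their common line
has distance at most one from the origin. -/
theorem exists_mem_sphere_of_cross_ne_zero
    (hD : 0 < (a₂ * c₃ - a₃ * c₂) ^ 2 + (a₃ * c₁ - a₁ * c₃) ^ 2 + (a₁ * c₂ - a₂ * c₁) ^ 2)
    (h : (c₀ * a₁ - a₀ * c₁) ^ 2 + (c₀ * a₂ - a₀ * c₂) ^ 2 + (c₀ * a₃ - a₀ * c₃) ^ 2 ≤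
      (a₂ * c₃ - a₃ * c₂) ^ 2 + (a₃ * c₁ - a₁ * c₃) ^ 2 + (a₁ * c₂ - a₂ * c₁) ^ 2) :
    ∃ x y z : ℝ, x ^ 2 + y ^ 2 + z ^ 2 = 1 ∧ a₁ * x + a₂ * y + a₃ * z = -a₀ ∧
      c₁ * x + c₂ * y + c₃ * z = -c₀ := by
  obtain ⟨m₁, hm₁⟩ : ∃ m, m = a₂ * c₃ - a₃ * c₂ := ⟨_, rfl⟩
  obtain ⟨m₂, hm₂⟩ : ∃ m, m = a₃ * c₁ - a₁ * c₃ := ⟨_, rfl⟩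
  obtain ⟨m₃, hm₃⟩ : ∃ m, m = a₁ * c₂ - a₂ * c₁ := ⟨_, rfl⟩
  obtain ⟨p₁, hp₁⟩ : ∃ p, p = c₀ * a₁ - a₀ * c₁ := ⟨_, rfl⟩
  obtain ⟨p₂, hp₂⟩ : ∃ p, p = c₀ * a₂ - a₀ * c₂ := ⟨_, rfl⟩
  obtain ⟨p₃, hp₃⟩ : ∃ p, p = c₀ * a₃ - a₀ * c₃ := ⟨_, rfl⟩
  rw [← hm₁, ← hm₂, ← hm₃] at hD h
  rw [← hp₁, ← hp₂, ← hp₃] at h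
  obtain ⟨D, hDdef⟩ : ∃ D, D = m₁ ^ 2 + m₂ ^ 2 + m₃ ^ 2 := ⟨_, rfl⟩
  rw [← hDdef] at hD h
  obtain ⟨s, hs⟩ : ∃ s : ℝ, s ^ 2 = D - (p₁ ^ 2 + p₂ ^ 2 + p₃ ^ 2) :=
    ⟨_, Real.sq_sqrt (sub_nonneg.2 h)⟩
  have hpm : p₁ * m₁ + p₂ * m₂ + p₃ * m₃ = 0 := by subst_vars; ring
  refine ⟨(p₂ * m₃ - p₃ * m₂ + s * m₁) / D, (p₃ * m₁ - p₁ * m₃ + s * m₂) / D,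
    (p₁ * m₂ - p₂ * m₁ + s * m₃) / D, ?_, ?_, ?_⟩
  · field_simp
    linear_combination (m₁ ^ 2 + m₂ ^ 2 + m₃ ^ 2) * hs - D * hDdef
      - (p₁ * m₁ + p₂ * m₂ + p₃ * m₃) * hpm
  · field_simp
    subst_vars
    ring
  · field_simp
    subst_vars
    ring

theorem exists_mem_sphere_of_plane (h : a₀ ^ 2 ≤ a₁ ^ 2 + a₂ ^ 2 + a₃ ^ 2)
    (ha : 0 < a₁ ^ 2 + a₂ ^ 2 + a₃ ^ 2) :
    ∃ x y z : ℝ, x ^ 2 + y ^ 2 + z ^ 2 = 1 ∧ a₁ * x + a₂ * y + a₃ * z = -a₀ := by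
  obtain ⟨c₁, c₂, c₃, hc, hac⟩ : ∃ c₁ c₂ c₃ : ℝ, 0 < c₁ ^ 2 + c₂ ^ 2 + c₃ ^ 2 ∧
      a₁ * c₁ + a₂ * c₂ + a₃ * c₃ = 0 := by
    by_cases h0 : a₁ = 0
    · exact ⟨1, 0, 0, by norm_num, by simp [h0]⟩
    · exact ⟨-a₂, a₁, 0, by positivity, by ring⟩
  have key : (a₂ * c₃ - a₃ * c₂) ^ 2 + (a₃ * c₁ - a₁ * c₃) ^ 2 + (a₁ * c₂ - a₂ * c₁) ^ 2 =
      (a₁ ^ 2 + a₂ ^ 2 + a₃ ^ 2) * (c₁ ^ 2 + c₂ ^ 2 + c₃ ^ 2) := by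
    linear_combination -(a₁ * c₁ + a₂ * c₂ + a₃ * c₃) * hac
  obtain ⟨x, y, z, hn, hx, -⟩ := exists_mem_sphere_of_cross_ne_zero (a₀ := a₀) (c₀ := 0)
    (key ▸ mul_pos ha hc) (by rw [key]; linarith [mul_le_mul_of_nonneg_right h hc.le])
  exact ⟨x, y, z, hn, hx⟩

theorem eq_zero_of_sum_three_sq_nonpos {x y z : ℝ} (h : x ^ 2 + y ^ 2 + z ^ 2 ≤ 0) :
    x = 0 ∧ y = 0 ∧ z = 0 := by
  refine ⟨?_, ?_, ?_⟩ <;> nlinarith [sq_nonneg x, sq_nonneg y, sq_nonneg z]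

/-- Criterion for two (possibly degenerate) planes to meet the unit sphere at a common point. -/
theorem exists_mem_sphere_iff :
    (∃ x y z : ℝ, x ^ 2 + y ^ 2 + z ^ 2 = 1 ∧ a₁ * x + a₂ * y + a₃ * z = -a₀ ∧
      c₁ * x + c₂ * y + c₃ * z = -c₀) ↔
    a₀ ^ 2 ≤ a₁ ^ 2 + a₂ ^ 2 + a₃ ^ 2 ∧ c₀ ^ 2 ≤ c₁ ^ 2 + c₂ ^ 2 + c₃ ^ 2 ∧
    (c₀ * a₁ - a₀ * c₁) ^ 2 + (c₀ * a₂ - a₀ * c₂) ^ 2 + (c₀ * a₃ - a₀ * c₃) ^ 2 ≤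
      (a₂ * c₃ - a₃ * c₂) ^ 2 + (a₃ * c₁ - a₁ * c₃) ^ 2 + (a₁ * c₂ - a₂ * c₁) ^ 2 := by
  constructor
  · rintro ⟨x, y, z, hn, ha, hc⟩
    obtain rfl : a₀ = -(a₁ * x + a₂ * y + a₃ * z) := by linarith
    obtain rfl : c₀ = -(c₁ * x + c₂ * y + c₃ * z) := by linarith
    refine ⟨?_, ?_, ?_⟩
    · rw [← mul_one (a₁ ^ 2 + a₂ ^ 2 + a₃ ^ 2), ← hn]
      linarith [sq_nonneg (a₂ * z - a₃ * y), sq_nonneg (a₃ * x - a₁ * z),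
        sq_nonneg (a₁ * y - a₂ * x)]
    · rw [← mul_one (c₁ ^ 2 + c₂ ^ 2 + c₃ ^ 2), ← hn]
      linarith [sq_nonneg (c₂ * z - c₃ * y), sq_nonneg (c₃ * x - c₁ * z),
        sq_nonneg (c₁ * y - c₂ * x)]
    · rw [← mul_one ((a₂ * c₃ - a₃ * c₂) ^ 2 + _ + _), ← hn]
      linarith [sq_nonneg ((a₂ * c₃ - a₃ * c₂) * x + (a₃ * c₁ - a₁ * c₃) * y
        + (a₁ * c₂ - a₂ * c₁) * z)]
  · rintro ⟨ha, hc, h⟩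
    rcases (show 0 ≤ (a₂ * c₃ - a₃ * c₂) ^ 2 + (a₃ * c₁ - a₁ * c₃) ^ 2
      + (a₁ * c₂ - a₂ * c₁) ^ 2 by positivity).eq_or_lt with hD | hD
    swap
    · exact exists_mem_sphere_of_cross_ne_zero hD h
    obtain ⟨hm₁, hm₂, hm₃⟩ := eq_zero_of_sum_three_sq_nonpos hD.ge
    obtain ⟨hp₁, hp₂, hp₃⟩ := eq_zero_of_sum_three_sq_nonpos (h.trans hD.ge)
    rcases (show 0 ≤ a₁ ^ 2 + a₂ ^ 2 + a₃ ^ 2 by positivity).eq_or_lt with hA | hA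
    · have e₀ : a₀ = 0 :=
        pow_eq_zero_iff two_ne_zero |>.1 (le_antisymm (ha.trans hA.ge) (sq_nonneg _))
      obtain ⟨e₁, e₂, e₃⟩ := eq_zero_of_sum_three_sq_nonpos hA.ge
      rcases (show 0 ≤ c₁ ^ 2 + c₂ ^ 2 + c₃ ^ 2 by positivity).eq_or_lt with hC | hC
      · have f₀ : c₀ = 0 :=
        pow_eq_zero_iff two_ne_zero |>.1 (le_antisymm (hc.trans hC.ge) (sq_nonneg _))
        obtain ⟨f₁, f₂, f₃⟩ := eq_zero_of_sum_three_sq_nonpos hC.ge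
        exact ⟨1, 0, 0, by norm_num, by simp [e₀, e₁], by simp [f₀, f₁]⟩
      · obtain ⟨x, y, z, hn, hx⟩ := exists_mem_sphere_of_plane hc hC
        exact ⟨x, y, z, hn, by simp [e₀, e₁, e₂, e₃], hx⟩
    · obtain ⟨x, y, z, hn, hx⟩ := exists_mem_sphere_of_plane ha hA
      refine ⟨x, y, z, hn, hx, ?_⟩
      apply mul_left_cancel₀ hA.ne'
      linear_combination (a₁ * c₁ + a₂ * c₂ + a₃ * c₃) * hx + a₁ * hp₁ + a₂ * hp₂ + a₃ * hp₃
        - (y * a₃ - z * a₂) * hm₁ - (z * a₁ - x * a₃) * hm₂ - (x * a₂ - y * a₁) * hm₃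

end PlanesAndSphere

/-- A determinant one matrix whose first column has norm `r` has a `QR` factorization with
diagonal `(r, r⁻¹)`. -/
theorem exists_unitary_conjTranspose_mul_upper {B : Matrix (Fin 2) (Fin 2) ℂ} (hB : B.det = 1)
    {r : ℝ} (hr : r ≠ 0) (h : (Bᴴ * B) 0 0 = (r : ℂ) ^ 2) :
    ∃ U ∈ Matrix.unitaryGroup (Fin 2) ℂ, (Uᴴ * B).BlockTriangular id ∧
      (Uᴴ * B) 0 0 = r ∧ (Uᴴ * B) 1 1 = (r : ℂ)⁻¹ := by
  have hr' : (r : ℂ) ≠ 0 := by exact_mod_cast hr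
  rw [Matrix.det_fin_two] at hB
  simp only [Matrix.mul_apply, Matrix.conjTranspose_apply, Fin.sum_univ_two, RCLike.star_def] at h
  refine ⟨!![B 0 0 / r, -star (B 1 0) / r; B 1 0 / r, star (B 0 0) / r], ?_, ?_, ?_, ?_⟩
  · rw [Matrix.mem_unitaryGroup_iff']
    ext i j
    fin_cases i <;> fin_cases j <;>
      simp [Matrix.star_eq_conjTranspose, Matrix.mul_apply, Fin.sum_univ_two] <;> field_simp <;>
      first | ring1 | linear_combination h
  · intro i j hij
    fin_cases i <;> fin_cases j <;> simp at hij
    simp [Matrix.mul_apply, Fin.sum_univ_two]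
    ring
  · simp [Matrix.mul_apply, Fin.sum_univ_two]
    field_simp
    linear_combination h
  · simp [Matrix.mul_apply, Fin.sum_univ_two]
    field_simp
    linear_combination hB

/-- A determinant one matrix whose second column has norm `r⁻¹` has a `QL` factorization with
diagonal `(r, r⁻¹)`. -/
theorem exists_unitary_conjTranspose_mul_lower {B : Matrix (Fin 2) (Fin 2) ℂ} (hB : B.det = 1)
    {r : ℝ} (hr : r ≠ 0) (h : (Bᴴ * B) 1 1 = ((r : ℂ) ^ 2)⁻¹) :
    ∃ U ∈ Matrix.unitaryGroup (Fin 2) ℂ, (Uᴴ * B)ᵀ.BlockTriangular id ∧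
      (Uᴴ * B) 0 0 = r ∧ (Uᴴ * B) 1 1 = (r : ℂ)⁻¹ := by
  have hr' : (r : ℂ) ≠ 0 := by exact_mod_cast hr
  rw [Matrix.det_fin_two] at hB
  simp only [Matrix.mul_apply, Matrix.conjTranspose_apply, Fin.sum_univ_two, RCLike.star_def] at h
  field_simp at h
  refine ⟨!![star (B 1 1) * r, B 0 1 * r; -star (B 0 1) * r, B 1 1 * r], ?_, ?_, ?_, ?_⟩
  · rw [Matrix.mem_unitaryGroup_iff']
    ext i j
    fin_cases i <;> fin_cases j <;>
      simp [Matrix.star_eq_conjTranspose, Matrix.mul_apply, Fin.sum_univ_two] <;>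
      first | ring1 | linear_combination h
  · intro i j hij
    fin_cases i <;> fin_cases j <;> simp at hij
    simp [Matrix.mul_apply, Fin.sum_univ_two]
    ring
  · simp [Matrix.mul_apply, Fin.sum_univ_two]
    linear_combination r * hB
  · simp [Matrix.mul_apply, Fin.sum_univ_two]
    field_simp
    linear_combination h

theorem conjTranspose_mul_sub_smul_one_mul {V : Matrix (Fin 2) (Fin 2) ℂ}
    (hV : V ∈ Matrix.unitaryGroup (Fin 2) ℂ) (A : Matrix (Fin 2) (Fin 2) ℂ) (c : ℂ) :
    Vᴴ * (Aᴴ * A - c • 1) * V = (A * V)ᴴ * (A * V) - c • 1 := by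
  have h := Matrix.mem_unitaryGroup_iff'.1 hV
  rw [Matrix.star_eq_conjTranspose] at h
  rw [mul_sub, sub_mul, Matrix.mul_smul, Matrix.smul_mul, mul_one, h, Matrix.conjTranspose_mul]
  simp only [Matrix.mul_assoc]

theorem conjTranspose_mul_self_of_unitary {U : Matrix (Fin 2) (Fin 2) ℂ}
    (hU : U ∈ Matrix.unitaryGroup (Fin 2) ℂ) (B : Matrix (Fin 2) (Fin 2) ℂ) :
    (Uᴴ * B)ᴴ * (Uᴴ * B) = Bᴴ * B := by
  have h := Matrix.mem_unitaryGroup_iff.1 hU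
  rw [Matrix.star_eq_conjTranspose] at h
  rw [Matrix.conjTranspose_mul, Matrix.conjTranspose_conjTranspose, Matrix.mul_assoc,
    ← Matrix.mul_assoc U, h, one_mul]

/-- **Joint triangularization with opposite decoding orders and diagonal `(r, 1/r)`.**
For complex `2 × 2` matrices `A₁, A₂` of unit determinant and `r > 0`, there exist unitary
matrices `U₁, U₂, V` such that `U₁ᴴ * A₁ * V` is upper triangular and `U₂ᴴ * A₂ * V` is
lower triangular, both with diagonal entries `r` and `1/r` (in this order), iff
`det(A₁ᴴA₁ − r²I) ≤ 0`, `det(A₂ᴴA₂ − (1/r²)I) ≤ 0`, and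
`F₂(A₁ᴴA₁ − r²I, A₂ᴴA₂ − (1/r²)I) ≥ 0`. -/
theorem upper_lower_triangularization_r (A₁ A₂ : Matrix (Fin 2) (Fin 2) ℂ)
    (h₁ : A₁.det = 1) (h₂ : A₂.det = 1) (r : ℝ) (hr : 0 < r) :
    (∃ U₁ U₂ V : Matrix (Fin 2) (Fin 2) ℂ,
        U₁ ∈ Matrix.unitaryGroup (Fin 2) ℂ ∧ U₂ ∈ Matrix.unitaryGroup (Fin 2) ℂ ∧
        V ∈ Matrix.unitaryGroup (Fin 2) ℂ ∧
        (U₁ᴴ * A₁ * V).BlockTriangular id ∧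
        (U₁ᴴ * A₁ * V) 0 0 = (r : ℂ) ∧ (U₁ᴴ * A₁ * V) 1 1 = ((r : ℂ))⁻¹ ∧
        ((U₂ᴴ * A₂ * V)ᵀ).BlockTriangular id ∧
        (U₂ᴴ * A₂ * V) 0 0 = (r : ℂ) ∧ (U₂ᴴ * A₂ * V) 1 1 = ((r : ℂ))⁻¹) ↔
      ((A₁ᴴ * A₁ - ((r : ℂ) ^ 2) • 1).det ≤ 0 ∧
        (A₂ᴴ * A₂ - (((r : ℂ) ^ 2)⁻¹) • 1).det ≤ 0 ∧
        0 ≤ F2 (A₁ᴴ * A₁ - ((r : ℂ) ^ 2) • 1) (A₂ᴴ * A₂ - (((r : ℂ) ^ 2)⁻¹) • 1)) := by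
  obtain ⟨a₀, a₁, a₂, a₃, hS₁⟩ : ∃ t x y z : ℝ,
      A₁ᴴ * A₁ - ((r : ℂ) ^ 2) • 1 = pauliMatrix t x y z :=
    Matrix.IsHermitian.exists_eq_pauliMatrix <| by
      simp [Matrix.IsHermitian, Matrix.conjTranspose_sub, Matrix.conjTranspose_mul]
  obtain ⟨b₀, b₁, b₂, b₃, hS₂⟩ : ∃ t x y z : ℝ,
      A₂ᴴ * A₂ - (((r : ℂ) ^ 2)⁻¹) • 1 = pauliMatrix t x y z :=
    Matrix.IsHermitian.exists_eq_pauliMatrix <| by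
      simp [Matrix.IsHermitian, Matrix.conjTranspose_sub, Matrix.conjTranspose_mul]
  have hiff := exists_mem_sphere_iff (a₀ := a₀) (a₁ := a₁) (a₂ := a₂) (a₃ := a₃)
    (c₀ := b₀) (c₁ := -b₁) (c₂ := -b₂) (c₃ := -b₃)
  trans ∃ x y z : ℝ, x ^ 2 + y ^ 2 + z ^ 2 = 1 ∧ a₁ * x + a₂ * y + a₃ * z = -a₀ ∧
      -b₁ * x + -b₂ * y + -b₃ * z = -b₀
  · constructor
    · rintro ⟨U₁, U₂, V, hU₁, hU₂, hV, hup, hup0, -, hlow, -, hlow1⟩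
      have hup' : (U₁ᴴ * A₁ * V) 1 0 = 0 := hup (by simp)
      have hlow' : (U₂ᴴ * A₂ * V) 0 1 = 0 := hlow (i := 1) (j := 0) (by simp)
      rw [Matrix.mul_assoc] at hup' hup0 hlow' hlow1
      have e₁ : (Vᴴ * (A₁ᴴ * A₁ - ((r : ℂ) ^ 2) • 1) * V) 0 0 = 0 := by
        rw [conjTranspose_mul_sub_smul_one_mul hV, ← conjTranspose_mul_self_of_unitary hU₁,
          Matrix.sub_apply, Matrix.mul_apply, Fin.sum_univ_two, Matrix.conjTranspose_apply,
          Matrix.conjTranspose_apply, hup', hup0]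
        simp
        ring
      have e₂ : (Vᴴ * (A₂ᴴ * A₂ - (((r : ℂ) ^ 2)⁻¹) • 1) * V) 1 1 = 0 := by
        rw [conjTranspose_mul_sub_smul_one_mul hV, ← conjTranspose_mul_self_of_unitary hU₂,
          Matrix.sub_apply, Matrix.mul_apply, Fin.sum_univ_two, Matrix.conjTranspose_apply,
          Matrix.conjTranspose_apply, hlow', hlow1]
        simp
        ring
      rw [hS₁, conjTranspose_mul_pauliMatrix_mul_zero_zero _ _ _ _ V hV,
        Complex.ofReal_eq_zero] at e₁
      rw [hS₂, conjTranspose_mul_pauliMatrix_mul_one_one _ _ _ _ V hV,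
        Complex.ofReal_eq_zero] at e₂
      have h := congrArg Complex.re (congrFun (congrFun (Matrix.mem_unitaryGroup_iff'.1 hV) 0) 0)
      simp [Matrix.star_eq_conjTranspose, Matrix.mul_apply, Fin.sum_univ_two] at h
      refine ⟨_, _, _, ?_, eq_neg_of_add_eq_zero_right e₁, by linear_combination e₂⟩
      linear_combination ((V 0 0).re ^ 2 + (V 0 0).im ^ 2 + (V 1 0).re ^ 2 + (V 1 0).im ^ 2 + 1) * h
    · rintro ⟨x, y, z, hn, ha, hb⟩
      obtain ⟨V, hV, hdet, hx, hy, hz⟩ := exists_unitary_bloch_eq x y z hn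
      have e₁ := conjTranspose_mul_pauliMatrix_mul_zero_zero a₀ a₁ a₂ a₃ V hV
      have e₂ := conjTranspose_mul_pauliMatrix_mul_one_one b₀ b₁ b₂ b₃ V hV
      rw [← hS₁, conjTranspose_mul_sub_smul_one_mul hV, hx, hy, hz, ha, add_neg_cancel,
        Complex.ofReal_zero, Matrix.sub_apply, sub_eq_zero] at e₁
      rw [← hS₂, conjTranspose_mul_sub_smul_one_mul hV, hx, hy, hz,
        show b₀ - (b₁ * x + b₂ * y + b₃ * z) = 0 by linarith,
        Complex.ofReal_zero, Matrix.sub_apply, sub_eq_zero] at e₂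
      obtain ⟨U₁, hU₁, hup⟩ := exists_unitary_conjTranspose_mul_upper (B := A₁ * V)
        (by simp [h₁, hdet]) hr.ne' (by simpa using e₁)
      obtain ⟨U₂, hU₂, hlow⟩ := exists_unitary_conjTranspose_mul_lower (B := A₂ * V)
        (by simp [h₂, hdet]) hr.ne' (by simpa using e₂)
      rw [← Matrix.mul_assoc] at hup hlow
      exact ⟨U₁, U₂, V, hU₁, hU₂, hV, hup.1, hup.2.1, hup.2.2, hlow⟩
  · rw [hiff, hS₁, hS₂, det_pauliMatrix, det_pauliMatrix, F2_pauliMatrix, ← Complex.ofReal_zero,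
      Complex.real_le_real, Complex.real_le_real, Complex.real_le_real]
    refine and_congr ?_ (and_congr ?_ ?_) <;> constructor <;> intro h <;> linarith
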